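/- The linear map B preserves the quadratic form Q_B: for every v ∈ ℝ², Q_B(B(v)) = Q_B(v). -/

import Mathlib

open Real Set Filter

noncomputable section

/-- A point in the plane. -/
abbrev Pt : Type := ℝ × ℝ

/-- The linear map `B` with matrix `(1/(t-s)) ⬝ [[t² - (1-s)², (1-2s)t], [(2s-1)t, (2t-1)t]]`. -/
def Bmap (s t : ℝ) : Pt → Pt := fun p =>
  ((1/(t-s)) * ((t^2 - (1-s)^2) * p.1 + (1-2*s)*t * p.2),
   (1/(t-s)) * ((2*s-1)*t * p.1 + (2*t-1)*t * p.2))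

/-- The quadratic form `Q_B(x,y) = t(x² + y²) - xy`. -/
def QB (t : ℝ) (p : Pt) : ℝ := t * (p.1^2 + p.2^2) - p.1 * p.2

/-- The linear map `B` preserves the quadratic form `Q_B`. -/
theorem Bmap_preserves_QB (t : ℝ) (ht : t ∈ Ioo (0:ℝ) (1/2))
    (s : ℝ) (hs : s = Real.sqrt (t - t^2)) :
    ∀ v : Pt, QB t (Bmap s t v) = QB t v := by
  rintro ⟨x, y⟩
  obtain ⟨ht0, ht1⟩ := ht
  have hs2 : s ^ 2 = t - t ^ 2 := by
    rw [hs, Real.sq_sqrt (by nlinarith)]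
  have hts : t - s ≠ 0 := by
    intro h
    obtain rfl : t = s := sub_eq_zero.mp h
    nlinarith
  have hentry : t ^ 2 - (1 - s) ^ 2 = 2 * t ^ 2 - t - 1 + 2 * s := by
    linear_combination -hs2
  simp only [QB, Bmap, hentry]
  field_simp
  linear_combination (t * ((2 * x - 2 * t * y) ^ 2 + (2 * t * x) ^ 2)
    - (2 * x - 2 * t * y) * (2 * t * x) - (t * (x ^ 2 + y ^ 2) - x * y)) * hs2
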